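/- Every convex combination of the eight self-dual 4-forms ω₁ = cay, ω₂, ω₃, ω₄, η₁, η₂, η₃, η₄ has comass exactly 1, and its value on (e₁, e₂, e₃, e₄) equals 1. -/

import Mathlib

noncomputable section

open scoped BigOperators
open Matrix

/-- `ℝ⁸` with its standard Euclidean structure. -/
abbrev E8 : Type := EuclideanSpace ℝ (Fin 8)

/-- The standard orthonormal basis `e₁, …, e₈` of `ℝ⁸`. -/
def stdB : Fin 8 → E8 := fun i => EuclideanSpace.single i 1

/-- The `j`-th coordinate functional `eʲ`. -/
def coordL (j : Fin 8) : E8 →ₗ[ℝ] ℝ :=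
  (LinearMap.proj j).comp (WithLp.linearEquiv 2 ℝ (Fin 8 → ℝ)).toLinearMap

/-- Alternating 4-forms on `ℝ⁸`. -/
abbrev Form4 : Type := AlternatingMap ℝ E8 ℝ (Fin 4)

/-- The decomposable 4-form `eᵃ∧eᵇ∧eᶜ∧eᵈ` (value `det` of the coordinates). -/
def wedge4 (a b c d : Fin 8) : Form4 :=
  (Matrix.detRowAlternating : AlternatingMap ℝ (Fin 4 → ℝ) ℝ (Fin 4)).compLinearMap
    (LinearMap.pi (fun i : Fin 4 => coordL (![a, b, c, d] i)))

/-- The comass `‖ω‖` of a 4-form: the sup of values on unit vectors. -/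
def comass (ω : Form4) : ℝ :=
  sSup {r : ℝ | ∃ v : Fin 4 → E8, (∀ i, ‖v i‖ = 1) ∧ ω v = r}

open scoped Classical in
/-- The square `|ω|²` of the Euclidean norm of a 4-form:
the sum of the squares of the coefficients over increasing multi-indices. -/
def eNormSq (ω : Form4) : ℝ :=
  ∑ f ∈ Finset.univ.filter (fun f : Fin 4 → Fin 8 => StrictMono f),
    (ω (fun i => stdB (f i))) ^ 2

/-- `e^{1234}` (1-indexed), i.e. `e¹∧e²∧e³∧e⁴` plus its Hodge dual. -/
def E1234 : Form4 := wedge4 0 1 2 3 + wedge4 4 5 6 7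
def E1256 : Form4 := wedge4 0 1 4 5 + wedge4 2 3 6 7
def E1278 : Form4 := wedge4 0 1 6 7 + wedge4 2 3 4 5
def E1357 : Form4 := wedge4 0 2 4 6 + wedge4 1 3 5 7
def E1467 : Form4 := wedge4 0 3 5 6 + wedge4 1 2 4 7
def E1368 : Form4 := wedge4 0 2 5 7 + wedge4 1 3 4 6
def E1458 : Form4 := wedge4 0 3 4 7 + wedge4 1 2 5 6

/-- The Cayley form. -/
def cay : Form4 := E1234 + E1256 + E1278 + E1357 - E1368 - E1458 - E1467

/-- A 4-form on `ℝ⁸` is self-dual if `ω(e_f) = ω(e_g)` whenever `f`, `g` are complementary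
increasing multi-indices whose concatenation is an even permutation of `(1,…,8)`
(i.e. induces the standard orientation). -/
def SelfDual (ω : Form4) : Prop :=
  ∀ (f g : Fin 4 → Fin 8) (σ : Equiv.Perm (Fin 8)),
    StrictMono f → StrictMono g →
    (∀ i : Fin 8, σ i = Fin.append f g (Fin.cast (by norm_num) i)) →
    Equiv.Perm.sign σ = 1 →
    ω (fun i => stdB (f i)) = ω (fun i => stdB (g i))

/-- Membership in `SO(8)`, as real `8 × 8` matrices. -/
def IsSO8 (g : Matrix (Fin 8) (Fin 8) ℝ) : Prop := g * gᵀ = 1 ∧ g.det = 1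

/-- The linear action of an `8 × 8` matrix on `ℝ⁸`. -/
def mulVecL (g : Matrix (Fin 8) (Fin 8) ℝ) : E8 →ₗ[ℝ] E8 :=
  (WithLp.linearEquiv 2 ℝ (Fin 8 → ℝ)).symm.toLinearMap ∘ₗ
    g.mulVecLin ∘ₗ (WithLp.linearEquiv 2 ℝ (Fin 8 → ℝ)).toLinearMap

/-- The action of a matrix `g` on 4-forms: `(g·ω)(v₁,…,v₄) = ω(g⁻¹v₁,…,g⁻¹v₄)`. -/
def formAct (g : Matrix (Fin 8) (Fin 8) ℝ) (ω : Form4) : Form4 :=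
  ω.compLinearMap (mulVecL g⁻¹)

/-- Two 4-forms are `SO(8)`-conjugate if they lie in the same orbit. -/
def SOConj (ω η : Form4) : Prop := ∃ g, IsSO8 g ∧ formAct g ω = η

/-- `ω₂` from Proposition `morecomassone`. -/
def omega2 : Form4 := E1234 + E1256 + E1278 - E1357 + E1467 + E1368 + E1458
def omega3 : Form4 := E1234 - E1256 - E1278 + E1357 + E1467 - E1368 + E1458
def omega4 : Form4 := E1234 - E1256 - E1278 - E1357 - E1467 + E1368 - E1458
def eta1 : Form4 := E1234 - E1256 + E1278 + E1357 + E1467 + E1368 - E1458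
def eta2 : Form4 := E1234 - E1256 + E1278 - E1357 - E1467 - E1368 + E1458
def eta3 : Form4 := E1234 + E1256 - E1278 + E1357 - E1467 + E1368 + E1458
def eta4 : Form4 := E1234 + E1256 - E1278 - E1357 + E1467 - E1368 - E1458

/-- The eight comass-one self-dual forms `ω₁ = cay, ω₂, ω₃, ω₄, η₁, η₂, η₃, η₄`. -/
def forms8 : Fin 8 → Form4 := ![cay, omega2, omega3, omega4, eta1, eta2, eta3, eta4]

open InnerProductSpace in
/-- A Gram-Schmidt vector is no longer than the vector it comes from. -/
theorem norm_gramSchmidt_le {E : Type*} [NormedAddCommGroup E] [InnerProductSpace ℝ E] {n : ℕ}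
    (v : Fin n → E) (i : Fin n) : ‖gramSchmidt ℝ v i‖ ≤ ‖v i‖ := by
  have hinner : inner ℝ (gramSchmidt ℝ v i) (v i) = ‖gramSchmidt ℝ v i‖ ^ 2 := by
    conv_lhs => rw [gramSchmidt_def'' ℝ v i]
    rw [inner_add_right, inner_sum, real_inner_self_eq_norm_sq, add_eq_left]
    refine Finset.sum_eq_zero fun j hj => ?_
    rw [inner_smul_right, gramSchmidt_orthogonal ℝ v (Finset.mem_Iio.1 hj).ne', mul_zero]
  have hle := real_inner_le_norm (gramSchmidt ℝ v i) (v i)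
  rw [hinner, sq] at hle
  rcases (norm_nonneg (gramSchmidt ℝ v i)).eq_or_lt with h | h
  · rw [← h]
    exact norm_nonneg _
  · exact le_of_mul_le_mul_left hle h

open InnerProductSpace in
/-- The Gram-Schmidt process does not change the value of an alternating map. -/
theorem AlternatingMap.map_gramSchmidt {E : Type*} [NormedAddCommGroup E] [InnerProductSpace ℝ E]
    {n : ℕ} (f : AlternatingMap ℝ E ℝ (Fin n)) (v : Fin n → E) :
    f (gramSchmidt ℝ v) = f v := by
  have hpartial : ∀ k ≤ n, f (fun i => if i.val < k then gramSchmidt ℝ v i else v i) = f v := by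
    intro k
    induction k with
    | zero => simp
    | succ k ih =>
      intro hk
      rw [← ih (by omega)]
      set u : Fin n → E := fun i => if i.val < k + 1 then gramSchmidt ℝ v i else v i with hu
      let m : Fin n := ⟨k, hk⟩
      have hupdate : (fun i : Fin n => if i.val < k then gramSchmidt ℝ v i else v i) =
          Function.update u m (u m + ∑ j ∈ Finset.Iio m,
            (inner ℝ (gramSchmidt ℝ v j) (v m) / ‖gramSchmidt ℝ v j‖ ^ 2) • u j) := by
        funext i
        rcases eq_or_ne i m with rfl | hi
        · have hsum : ∀ j ∈ Finset.Iio m, u j = gramSchmidt ℝ v j := fun j hj =>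
            if_pos (Nat.lt_succ_of_lt (Fin.lt_def.1 (Finset.mem_Iio.1 hj)))
          have hm : u m = gramSchmidt ℝ v m := if_pos (Nat.lt_succ_self k)
          rw [Function.update_self, hm, if_neg (lt_irrefl k)]
          rw [Finset.sum_congr rfl fun j hj => by rw [hsum j hj]]
          exact gramSchmidt_def'' ℝ v m
        · have hik : i.val ≠ k := fun h => hi (Fin.ext h)
          rw [Function.update_of_ne hi, hu]
          exact if_congr (by omega) rfl rfl
      rw [hupdate, f.map_update_add, Function.update_eq_self, f.map_update_sum, eq_comm,
        add_eq_left]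
      refine Finset.sum_eq_zero fun j hj => ?_
      rw [f.map_update_smul, f.map_update_self _ (Finset.mem_Iio.1 hj).ne', smul_zero]
  simpa using hpartial n le_rfl

/-- An alternating map bounded by the product of the norms on orthogonal families is so bounded
on all families. -/
theorem AlternatingMap.abs_le_prod_norm_of_orthogonal {E : Type*} [NormedAddCommGroup E]
    [InnerProductSpace ℝ E] {n : ℕ} (f : AlternatingMap ℝ E ℝ (Fin n))
    (hf : ∀ v : Fin n → E, Pairwise (fun i j => inner ℝ (v i) (v j) = 0) → |f v| ≤ ∏ i, ‖v i‖)
    (v : Fin n → E) : |f v| ≤ ∏ i, ‖v i‖ := by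
  rw [← f.map_gramSchmidt v]
  exact (hf _ (InnerProductSpace.gramSchmidt_pairwise_orthogonal ℝ v)).trans
    (Finset.prod_le_prod (fun _ _ => norm_nonneg _) fun i _ => norm_gramSchmidt_le v i)

theorem wedge4_apply (a b c d : Fin 8) (v : Fin 4 → E8) :
    wedge4 a b c d v = Matrix.det (Matrix.of fun i j => v i (![a, b, c, d] j)) :=
  rfl

/-- The Plücker coordinates of a pair of vectors of `ℝ⁸`. -/
def pluecker (x y : E8) (i j : Fin 8) : ℝ := x i * y j - x j * y i

/-- Laplace expansion of `wedge4` along the first two rows. -/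
theorem wedge4_eq_pluecker (a b c d : Fin 8) (v : Fin 4 → E8) :
    wedge4 a b c d v =
      pluecker (v 0) (v 1) a b * pluecker (v 2) (v 3) c d -
      pluecker (v 0) (v 1) a c * pluecker (v 2) (v 3) b d +
      pluecker (v 0) (v 1) a d * pluecker (v 2) (v 3) b c +
      pluecker (v 0) (v 1) b c * pluecker (v 2) (v 3) a d -
      pluecker (v 0) (v 1) b d * pluecker (v 2) (v 3) a c +
      pluecker (v 0) (v 1) c d * pluecker (v 2) (v 3) a b := by
  rw [wedge4_apply]
  simp [Matrix.det_succ_row_zero, Fin.sum_univ_succ, Fin.succAbove, pluecker]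
  ring

/-- The cross product of two vectors of `ℝ⁸`, with values in `ℝ⁷`, attached to the Cayley form:
the imaginary part of an octonionic product. -/
def cayleyCross (x y : E8) : EuclideanSpace ℝ (Fin 7) :=
  let p := pluecker x y
  !₂[p 0 1 + p 2 3 + p 4 5 + p 6 7, p 0 2 - p 1 3 + p 4 6 - p 5 7,
    p 0 3 + p 1 2 - p 4 7 - p 5 6, p 0 4 - p 1 5 - p 2 6 + p 3 7,
    p 0 5 + p 1 4 + p 2 7 + p 3 6, p 0 6 - p 1 7 + p 2 4 - p 3 5,
    p 0 7 + p 1 6 - p 2 5 - p 3 4]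

theorem inner_cayleyCross (v : Fin 4 → E8) :
    inner ℝ (cayleyCross (v 0) (v 1)) (cayleyCross (v 2) (v 3)) =
      cay v + inner ℝ (v 0) (v 2) * inner ℝ (v 1) (v 3) -
        inner ℝ (v 0) (v 3) * inner ℝ (v 1) (v 2) := by
  simp only [cay, E1234, E1256, E1278, E1357, E1467, E1368, E1458, AlternatingMap.add_apply,
    AlternatingMap.sub_apply, wedge4_eq_pluecker, cayleyCross, PiLp.inner_apply,
    Fin.sum_univ_seven, Fin.sum_univ_eight, Matrix.cons_val, pluecker, RCLike.inner_apply,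
    conj_trivial]
  ring

theorem norm_cayleyCross_le (x y : E8) : ‖cayleyCross x y‖ ≤ ‖x‖ * ‖y‖ := by
  have h := inner_cayleyCross ![x, y, x, y]
  have hzero : cay ![x, y, x, y] = 0 :=
    cay.map_eq_zero_of_eq _ (i := 0) (j := 2) rfl (by decide)
  simp only [hzero, Matrix.cons_val, real_inner_self_eq_norm_sq, real_inner_comm x y] at h
  refine abs_le_of_sq_le_sq' ?_ (by positivity) |>.2
  nlinarith [sq_nonneg (inner ℝ x y)]

/-- The Cayley form is bounded by the product of the norms. -/
theorem abs_cay_le (v : Fin 4 → E8) : |cay v| ≤ ∏ i, ‖v i‖ := by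
  refine cay.abs_le_prod_norm_of_orthogonal (fun w hw => ?_) v
  have h := inner_cayleyCross w
  rw [hw (by decide : (0 : Fin 4) ≠ 2), hw (by decide : (0 : Fin 4) ≠ 3), zero_mul, zero_mul,
    add_zero, sub_zero] at h
  rw [← h, Fin.prod_univ_four, mul_assoc]
  exact (abs_real_inner_le_norm _ _).trans (mul_le_mul (norm_cayleyCross_le _ _)
    (norm_cayleyCross_le _ _) (norm_nonneg _) (by positivity))

/-- Coordinatewise multiplication by `s`. -/
def diagL (s : Fin 8 → ℝ) (x : E8) : E8 := WithLp.toLp 2 fun i => s i * x i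

theorem norm_diagL {s : Fin 8 → ℝ} (hs : ∀ i, s i ^ 2 = 1) (x : E8) : ‖diagL s x‖ = ‖x‖ := by
  simp [EuclideanSpace.norm_eq, diagL, mul_pow, hs]

theorem wedge4_diagL (s : Fin 8 → ℝ) (a b c d : Fin 8) (v : Fin 4 → E8) :
    wedge4 a b c d (fun i => diagL s (v i)) = s a * s b * s c * s d * wedge4 a b c d v := by
  have h := Matrix.det_mul_row (fun j => s (![a, b, c, d] j))
    (Matrix.of fun i j => v i (![a, b, c, d] j))
  rw [Fin.prod_univ_four] at h
  exact h

/-- Each of the eight forms is, up to sign, a diagonal pullback of the Cayley form. -/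
theorem abs_forms8_eq (i : Fin 8) : ∃ s : Fin 8 → ℝ, (∀ j, s j ^ 2 = 1) ∧
    ∀ v : Fin 4 → E8, |forms8 i v| = |cay fun j => diagL s (v j)| := by
  refine ⟨![![1, 1, 1, 1, 1, 1, 1, 1], ![-1, -1, 1, 1, 1, 1, 1, 1], ![-1, 1, -1, 1, 1, 1, 1, 1],
    ![-1, 1, 1, -1, 1, 1, 1, 1], ![-1, 1, 1, 1, 1, -1, 1, 1], ![-1, 1, 1, 1, -1, 1, 1, 1],
    ![-1, 1, 1, 1, 1, 1, 1, -1], ![-1, 1, 1, 1, 1, 1, -1, 1]] i, ?_, fun v => ?_⟩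
  · fin_cases i <;> simp [Fin.forall_fin_succ]
  · rw [abs_eq_abs]
    fin_cases i
    iterate 4
      · left
        simp [forms8, cay, omega2, omega3, omega4, E1234, E1256, E1278, E1357, E1467, E1368,
          E1458, wedge4_diagL]
        try ring
    iterate 4
      · right
        simp [forms8, cay, eta1, eta2, eta3, eta4, E1234, E1256, E1278, E1357, E1467, E1368,
          E1458, wedge4_diagL]
        ring

theorem forms8_le_one (i : Fin 8) {v : Fin 4 → E8} (hv : ∀ j, ‖v j‖ = 1) : forms8 i v ≤ 1 := by
  obtain ⟨s, hs, h⟩ := abs_forms8_eq i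
  refine (le_abs_self _).trans ?_
  rw [h v]
  refine (abs_cay_le _).trans_eq ?_
  simp [norm_diagL hs, hv]

theorem forms8_stdB (i : Fin 8) : forms8 i ![stdB 0, stdB 1, stdB 2, stdB 3] = 1 := by
  fin_cases i <;>
    simp [forms8, cay, omega2, omega3, omega4, eta1, eta2, eta3, eta4, E1234, E1256, E1278,
      E1357, E1467, E1368, E1458, wedge4_eq_pluecker, pluecker, stdB]

/-- Every convex combination of the eight forms `ω₁ = cay, ω₂, ω₃, ω₄, η₁, η₂, η₃, η₄`
has comass exactly `1`, and value `1` on `(e₁, e₂, e₃, e₄)`. -/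
theorem convex_comb_comass_one (a : Fin 8 → ℝ) (ha : ∀ i, 0 ≤ a i)
    (hsum : ∑ i, a i = 1) :
    comass (∑ i, a i • forms8 i) = 1 ∧
      (∑ i, a i • forms8 i) ![stdB 0, stdB 1, stdB 2, stdB 3] = 1 := by
  have happly (v : Fin 4 → E8) : (∑ i, a i • forms8 i) v = ∑ i, a i * forms8 i v := by
    simp [Fin.sum_univ_eight]
  have hval : (∑ i, a i • forms8 i) ![stdB 0, stdB 1, stdB 2, stdB 3] = 1 := by
    simp only [happly, forms8_stdB, mul_one, hsum]
  refine ⟨IsGreatest.csSup_eq ⟨⟨_, fun i => ?_, hval⟩, ?_⟩, hval⟩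
  · fin_cases i <;> simp [stdB]
  · rintro r ⟨v, hv, rfl⟩
    rw [happly, ← hsum]
    exact Finset.sum_le_sum fun i _ => mul_le_of_le_one_right (ha i) (forms8_le_one i hv)
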